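/- arXiv:0706.4015 — 3 statements merged into one kernel-verified Lean document; each statement's English description precedes it below -/
import Mathlib

section
/- The predicate WU₀ is closed under steps of the unison protocol: if WU₀(γ) holds and γ ↦ γ' is an NA-step, then WU₀(γ') holds; that is, γ' satisfies WU and the delay remains intrinsic (independent of the chosen path) in γ'. -/
open SimpleGraph

/-- The incrementing function `φ`: `φ(x) = (x+1) mod K` if `x ≥ 0`, and `x+1` if `x < 0`. -/
def phiInc (K x : ℤ) : ℤ := if 0 ≤ x then (x + 1) % K else x + 1

/-- `dsub K a b` is `b ⊖ a`: `(b−a) mod K` if this residue is `≤ 1`, else `−((a−b) mod K)`. -/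
def dsub (K a b : ℤ) : ℤ := if (b - a) % K ≤ 1 then (b - a) % K else -((a - b) % K)

/-- Two ring values are locally comparable if `min((a−b) mod K, (b−a) mod K) ≤ 1`. -/
def LocComp (K a b : ℤ) : Prop := min ((a - b) % K) ((b - a) % K) ≤ 1

/-- The predicate `WU`: every process has a ring value (`{0,…,K−1}`) locally comparable
with the value of each of its neighbors. -/
def WU {V : Type*} (G : SimpleGraph V) (K : ℤ) (γ : V → ℤ) : Prop :=
  ∀ p q : V, G.Adj p q → (0 ≤ γ p ∧ γ p < K) ∧ LocComp K (γ p) (γ q)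

/-- The delay of a walk: the sum of `γ(next) ⊖ γ(current)` along its edges. -/
def walkDelay {V : Type*} {G : SimpleGraph V} (K : ℤ) (γ : V → ℤ)
    {p q : V} (w : G.Walk p q) : ℤ :=
  (w.darts.map (fun d => dsub K (γ d.fst) (γ d.snd))).sum

/-- The delay is intrinsic: independent of the choice of the path. -/
def Intrinsic {V : Type*} (G : SimpleGraph V) (K : ℤ) (γ : V → ℤ) : Prop :=
  ∀ p q : V, ∀ w₁ w₂ : G.Walk p q, walkDelay K γ w₁ = walkDelay K γ w₂

/-- The normal action `NA` is enabled at `p`: `γ(p)` is a ring value and every neighbor `q`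
satisfies `γ(q) = γ(p)` or `γ(q) = φ(γ(p))`. -/
def NAenabled {V : Type*} (G : SimpleGraph V) (K : ℤ) (γ : V → ℤ) (p : V) : Prop :=
  (0 ≤ γ p ∧ γ p < K) ∧ ∀ q : V, G.Adj p q → γ q = γ p ∨ γ q = phiInc K (γ p)

/-- An NA-step: a nonempty set `S` of processes at which `NA` is enabled in `γ`
simultaneously execute it, all other processes keeping their value. -/
def NAstep {V : Type*} (G : SimpleGraph V) (K : ℤ) (γ γ' : V → ℤ) (S : Set V) : Prop :=
  S.Nonempty ∧ (∀ p ∈ S, NAenabled G K γ p) ∧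
    ∀ p : V, (p ∈ S → γ' p = phiInc K (γ p)) ∧ (p ∉ S → γ' p = γ p)

theorem emod_eq_ite_of_lt {K x : ℤ} (h₁ : -K < x) (h₂ : x < K) :
    x % K = if x < 0 then x + K else x := by
  split_ifs with h
  · rw [← Int.add_emod_right, Int.emod_eq_of_lt (by omega) (by omega)]
  · exact Int.emod_eq_of_lt (by omega) h₂

theorem phiInc_eq_ite {K a : ℤ} (h₀ : 0 ≤ a) (h₁ : a < K) :
    phiInc K a = if a + 1 = K then 0 else a + 1 := by
  rw [phiInc, if_pos h₀]
  split_ifs with h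
  · rw [h, Int.emod_self]
  · exact Int.emod_eq_of_lt (by omega) (by omega)

theorem phiInc_mem_ring {K a : ℤ} (h₀ : 0 ≤ a) (h₁ : a < K) :
    0 ≤ phiInc K a ∧ phiInc K a < K := by
  rw [phiInc_eq_ite h₀ h₁]
  split_ifs <;> omega

theorem locComp_iff {K a b : ℤ} (ha : 0 ≤ a ∧ a < K) (hb : 0 ≤ b ∧ b < K) :
    LocComp K a b ↔
      b = a ∨ b = phiInc K a ∨ a = phiInc K b := by
  rw [LocComp, min_le_iff, emod_eq_ite_of_lt (by omega) (by omega),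
    emod_eq_ite_of_lt (by omega) (by omega), phiInc_eq_ite ha.1 ha.2, phiInc_eq_ite hb.1 hb.2]
  split_ifs <;> omega

theorem dsub_self {K : ℤ} (a : ℤ) : dsub K a a = 0 := by
  simp [dsub]

theorem dsub_phiInc_right {K a : ℤ} (hK : 3 ≤ K) (ha : 0 ≤ a ∧ a < K) :
    dsub K a (phiInc K a) = 1 := by
  have h := phiInc_mem_ring ha.1 ha.2
  rw [dsub, emod_eq_ite_of_lt (by omega) (by omega), emod_eq_ite_of_lt (by omega) (by omega)]
  rw [phiInc_eq_ite ha.1 ha.2] at h ⊢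
  split_ifs <;> omega

theorem dsub_phiInc_left {K a : ℤ} (hK : 3 ≤ K) (ha : 0 ≤ a ∧ a < K) :
    dsub K (phiInc K a) a = -1 := by
  have h := phiInc_mem_ring ha.1 ha.2
  rw [dsub, emod_eq_ite_of_lt (by omega) (by omega), emod_eq_ite_of_lt (by omega) (by omega)]
  rw [phiInc_eq_ite ha.1 ha.2] at h ⊢
  split_ifs <;> omega

theorem phiInc_phiInc_ne {K a : ℤ} (hK : 3 ≤ K) (ha : 0 ≤ a ∧ a < K) :
    phiInc K (phiInc K a) ≠ a := by
  have h := phiInc_mem_ring ha.1 ha.2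
  rw [phiInc_eq_ite h.1 h.2, phiInc_eq_ite ha.1 ha.2]
  split_ifs <;> omega

/-- If the value of every edge changes by a coboundary, so does the delay of every walk. -/
theorem walkDelay_eq_add_sub {V : Type*} {G : SimpleGraph V} {K : ℤ} {γ γ' f : V → ℤ}
    (h : ∀ p q, G.Adj p q → dsub K (γ' p) (γ' q) = dsub K (γ p) (γ q) + f q - f p)
    {p q : V} (w : G.Walk p q) : walkDelay K γ' w = walkDelay K γ w + f q - f p := by
  induction w with
  | nil => simp [walkDelay]
  | cons hadj w ih =>
    simp only [walkDelay, Walk.darts_cons, List.map_cons, List.sum_cons] at ih ⊢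
    rw [ih, h _ _ hadj]
    ring

open Classical in
/-- An NA-step preserves local comparability along an edge, and shifts the delay of the edge by
the difference of the moves of its endpoints. -/
theorem NAstep.edge {V : Type*} {G : SimpleGraph V} {K : ℤ} (hK : 3 ≤ K) {γ γ' : V → ℤ}
    {S : Set V} (hWU : WU G K γ) (hstep : NAstep G K γ γ' S) {p q : V} (hpq : G.Adj p q) :
    ((0 ≤ γ' p ∧ γ' p < K) ∧ LocComp K (γ' p) (γ' q)) ∧
      dsub K (γ' p) (γ' q) =
        dsub K (γ p) (γ q) + (if q ∈ S then 1 else 0) - (if p ∈ S then 1 else 0) := by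
  obtain ⟨-, hen, hval⟩ := hstep
  have hp := (hWU p q hpq).1
  have hq := (hWU q p hpq.symm).1
  have hp' := phiInc_mem_ring hp.1 hp.2
  have hq' := phiInc_mem_ring hq.1 hq.2
  by_cases hpS : p ∈ S <;> by_cases hqS : q ∈ S
  · have h₁ := (hen p hpS).2 q hpq
    have h₂ := (hen q hqS).2 p hpq.symm
    have heq : γ q = γ p := by
      rcases h₁ with h₁ | h₁
      · exact h₁
      · rcases h₂ with h₂ | h₂
        · exact h₂.symm
        · rw [h₁] at h₂
          exact absurd h₂.symm (phiInc_phiInc_ne hK hp)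
    rw [(hval p).1 hpS, (hval q).1 hqS, heq]
    exact ⟨⟨hp', (locComp_iff hp' hp').2 (Or.inl rfl)⟩, by simp [dsub_self, hpS, hqS]⟩
  · rw [(hval p).1 hpS, (hval q).2 hqS]
    refine ⟨⟨hp', (locComp_iff hp' hq).2 ?_⟩, ?_⟩
    · rcases (hen p hpS).2 q hpq with h | h <;> simp [h]
    · rcases (hen p hpS).2 q hpq with h | h <;>
        simp [h, hpS, hqS, dsub_self, dsub_phiInc_left hK hp, dsub_phiInc_right hK hp]
  · rw [(hval p).2 hpS, (hval q).1 hqS]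
    refine ⟨⟨hp, (locComp_iff hp hq').2 ?_⟩, ?_⟩
    · rcases (hen q hqS).2 p hpq.symm with h | h <;> simp [h]
    · rcases (hen q hqS).2 p hpq.symm with h | h <;>
        simp [h, hpS, hqS, dsub_self, dsub_phiInc_left hK hq, dsub_phiInc_right hK hq]
  · rw [(hval p).2 hpS, (hval q).2 hqS]
    exact ⟨hWU p q hpq, by simp [hpS, hqS]⟩

/-- The predicate `WU₀` is closed under steps of the unison protocol: if `γ` satisfies `WU`
with intrinsic delay and `γ ↦ γ'` is an NA-step, then `γ'` satisfies `WU` and the delay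
remains intrinsic (independent of the chosen path) in `γ'`. -/
theorem WU0_closed {V : Type*} [Fintype V] (G : SimpleGraph V)
    (hconn : G.Connected) (hn : 2 ≤ Fintype.card V)
    (K α : ℤ) (hK : 3 ≤ K) (hα : 0 ≤ α)
    (γ γ' : V → ℤ) (hX : ∀ p : V, -α ≤ γ p ∧ γ p < K)
    (S : Set V) (hWU : WU G K γ) (hintr : Intrinsic G K γ)
    (hstep : NAstep G K γ γ' S) :
    WU G K γ' ∧ Intrinsic G K γ' := by
  classical
  refine ⟨fun p q hpq => (hstep.edge hK hWU hpq).1, fun p q w₁ w₂ => ?_⟩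
  have h := fun p q hpq => (hstep.edge (p := p) (q := q) hK hWU hpq).2
  rw [walkDelay_eq_add_sub (f := fun v => if v ∈ S then 1 else 0) h w₁,
    walkDelay_eq_add_sub (f := fun v => if v ∈ S then 1 else 0) h w₂, hintr p q w₁ w₂]
end

section
/- Deadlock implies legitimacy for the self-stabilizing wave-stream algorithm: if γ is a configuration in which no action of the algorithm is enabled at any process — i.e., for every process p the guards NormalStep_p, ConvergenceStep_p and ResetInit_p are all false in γ — then γ satisfies WU. -/
open SimpleGraph

/-- Guard `ConvergenceStep_p`: `γ(p) ∈ tail* = {−α,…,−1}` and every neighbor `q` has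
`γ(q) ∈ tail = {−α,…,0}` with `γ(p) ≤ γ(q)`. -/
def ConvergenceStep {V : Type*} (G : SimpleGraph V) (α : ℤ) (γ : V → ℤ) (p : V) : Prop :=
  (-α ≤ γ p ∧ γ p < 0) ∧ ∀ q : V, G.Adj p q → (-α ≤ γ q ∧ γ q ≤ 0) ∧ γ p ≤ γ q

/-- Guard `LocallyCorrect_p`: `γ(p)` is a ring value and every neighbor `q` has a ring value
with `γ(p) = γ(q)`, `γ(p) = φ(γ(q))` or `φ(γ(p)) = γ(q)`. -/
def LocallyCorrect {V : Type*} (G : SimpleGraph V) (K : ℤ) (γ : V → ℤ) (p : V) : Prop :=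
  (0 ≤ γ p ∧ γ p < K) ∧ ∀ q : V, G.Adj p q → (0 ≤ γ q ∧ γ q < K) ∧
    (γ p = γ q ∨ γ p = phiInc K (γ q) ∨ phiInc K (γ p) = γ q)

/-- Guard `NormalStep_p`: `γ(p)` is a ring value and every neighbor `q` satisfies
`γ(q) = γ(p)` or `γ(q) = φ(γ(p))`. -/
def NormalStep {V : Type*} (G : SimpleGraph V) (K : ℤ) (γ : V → ℤ) (p : V) : Prop :=
  (0 ≤ γ p ∧ γ p < K) ∧ ∀ q : V, G.Adj p q → γ q = γ p ∨ γ q = phiInc K (γ p)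

/-- Guard `ResetInit_p`: `p` is not locally correct and `γ(p) ∉ tail = {−α,…,0}`. -/
def ResetInit {V : Type*} (G : SimpleGraph V) (K α : ℤ) (γ : V → ℤ) (p : V) : Prop :=
  ¬ LocallyCorrect G K γ p ∧ ¬ (-α ≤ γ p ∧ γ p ≤ 0)

theorem LocComp.symm {K a b : ℤ} (h : LocComp K a b) : LocComp K b a := by
  unfold LocComp at *
  rwa [min_comm]

theorem LocComp.refl (K a : ℤ) : LocComp K a a := by
  simp [LocComp]

theorem locComp_phiInc {K x : ℤ} (hK : 2 ≤ K) (hx : 0 ≤ x) : LocComp K (phiInc K x) x := by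
  refine (min_le_left _ _).trans (le_of_eq ?_)
  rw [phiInc, if_pos hx, Int.emod_sub_emod, add_sub_cancel_left]
  exact Int.emod_eq_of_lt zero_le_one (by omega)

theorem LocallyCorrect.locComp {V : Type*} {G : SimpleGraph V} {K : ℤ} {γ : V → ℤ} {p q : V}
    (hK : 2 ≤ K) (h : LocallyCorrect G K γ p) (hpq : G.Adj p q) : LocComp K (γ p) (γ q) := by
  obtain ⟨hq, heq | heq | heq⟩ := h.2 q hpq
  · exact heq ▸ LocComp.refl K _
  · exact heq ▸ locComp_phiInc hK hq.1
  · exact heq ▸ (locComp_phiInc hK h.1.1).symm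

theorem locallyCorrect_of_not_resetInit {V : Type*} {G : SimpleGraph V} {K α : ℤ} {γ : V → ℤ}
    {p : V} (h : ¬ ResetInit G K α γ p) (hp : 0 < γ p) : LocallyCorrect G K γ p := by
  by_contra hc
  exact h ⟨hc, fun ht => by omega⟩

/-- Deadlock implies legitimacy for the self-stabilizing wave-stream algorithm: if no guard
of the algorithm is enabled at any process of a configuration `γ`, then `γ` satisfies `WU`. -/
theorem deadlock_implies_WU {V : Type*} [Fintype V] (G : SimpleGraph V)
    (hconn : G.Connected) (hn : 2 ≤ Fintype.card V)
    (K α : ℤ) (hK : 3 ≤ K) (hα : 1 ≤ α)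
    (γ : V → ℤ) (hX : ∀ p : V, -α ≤ γ p ∧ γ p < K)
    (hdead : ∀ p : V, ¬ NormalStep G K γ p ∧ ¬ ConvergenceStep G α γ p ∧
      ¬ ResetInit G K α γ p) :
    WU G K γ := by
  have : Nonempty V := hconn.nonempty
  have hcorrect (p : V) (hp : 0 < γ p) : LocallyCorrect G K γ p :=
    locallyCorrect_of_not_resetInit (hdead p).2.2 hp
  obtain ⟨m, hm⟩ := Finite.exists_min γ
  have hm0 : 0 ≤ γ m := by
    by_contra! hneg
    refine (hdead m).2.1 ⟨⟨(hX m).1, hneg⟩, fun q hq => ⟨⟨(hX q).1, ?_⟩, hm q⟩⟩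
    by_contra! hpos
    exact absurd ((hcorrect q hpos).2 m hq.symm).1.1 (not_le.mpr hneg)
  have hring (p : V) : 0 ≤ γ p := hm0.trans (hm p)
  intro p q hpq
  refine ⟨⟨hring p, (hX p).2⟩, ?_⟩
  rcases (hring p).lt_or_eq with hp | hp
  · exact (hcorrect p hp).locComp (by omega) hpq
  rcases (hring q).lt_or_eq with hq | hq
  · exact ((hcorrect q hq).locComp (by omega) hpq.symm).symm
  · rw [← hp, ← hq]
    exact LocComp.refl K 0
end

section
/- In any execution from a configuration in WU₀ in which every process has infinitely many events, for every k ≥ ⊥₀ + D the cut C_k = {(p, t_{p,k}) : p ∈ V} is well defined and coherent: whenever (q,t') ≼ (p,t) and t ≤ t_{p,k}, then t' ≤ t_{q,k}. -/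
open SimpleGraph

/-- `γ` takes values in `X = {−α,…,K−1}`. -/
def InX {V : Type*} (K α : ℤ) (γ : V → ℤ) : Prop := ∀ p : V, -α ≤ γ p ∧ γ p < K

/-- `WU₀`: `WU` together with intrinsic delay. -/
def WU0 {V : Type*} (G : SimpleGraph V) (K : ℤ) (γ : V → ℤ) : Prop :=
  WU G K γ ∧ Intrinsic G K γ

/-- `(p,t)` is an event: `t = 0`, or `p` executes `NA` in the step `γ_{t−1} ↦ γ_t`. -/
def isEvent {V : Type*} (sched : ℕ → Set V) (p : V) (t : ℕ) : Prop :=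
  t = 0 ∨ ∃ s, t = s + 1 ∧ p ∈ sched s

/-- The causal relation `⤳` on events. -/
inductive Leads {V : Type*} (G : SimpleGraph V) (sched : ℕ → Set V) :
    V × ℕ → V × ℕ → Prop
  | self {p : V} {t' t : ℕ} : isEvent sched p t' → isEvent sched p t → t' < t →
      (∀ s, t' < s → s < t → ¬ isEvent sched p s) → Leads G sched (p, t') (p, t)
  | nbr {p q : V} {t' t : ℕ} : G.Adj p q → isEvent sched p t → 0 < t →
      isEvent sched q t' → t' < t → (∀ s, t' < s → s < t → ¬ isEvent sched q s) →
      Leads G sched (q, t') (p, t)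

/-- The causal order `≼`: reflexive-transitive closure of `⤳`. -/
def CausalLe {V : Type*} (G : SimpleGraph V) (sched : ℕ → Set V) :
    V × ℕ → V × ℕ → Prop :=
  Relation.ReflTransGen (Leads G sched)

/-- The lifted clock `ṽ(p,t) = ⊥₀ + δ(p₀,p) + #{s : 0 < s ≤ t and (p,s) is an event}`. -/
noncomputable def liftClock {V : Type*} (sched : ℕ → Set V) (bot0 : ℤ) (δ0 : V → ℤ)
    (p : V) (t : ℕ) : ℤ :=
  bot0 + δ0 p + Nat.card {s : ℕ // 0 < s ∧ s ≤ t ∧ isEvent sched p s}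

section Clock

variable {V : Type*} {G : SimpleGraph V} {K bot0 : ℤ} {sched : ℕ → Set V} {δ0 : V → ℤ}

theorem isEvent_succ_iff {p : V} {t : ℕ} : isEvent sched p (t + 1) ↔ p ∈ sched t := by
  simp [isEvent]

theorem liftClock_zero (p : V) : liftClock sched bot0 δ0 p 0 = bot0 + δ0 p := by
  have : IsEmpty {s : ℕ // 0 < s ∧ s ≤ 0 ∧ isEvent sched p s} := ⟨fun s => by
    have := s.2.1
    have := s.2.2.1
    omega⟩
  rw [liftClock, Nat.card_of_isEmpty, Nat.cast_zero, add_zero]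

theorem setOf_events_succ (p : V) (t : ℕ) :
    {s : ℕ | 0 < s ∧ s ≤ t + 1 ∧ isEvent sched p s} =
      {s : ℕ | 0 < s ∧ s ≤ t ∧ isEvent sched p s} ∪ {s | s = t + 1 ∧ p ∈ sched t} := by
  ext s
  simp only [Set.mem_ofPred_eq, Set.mem_union]
  constructor
  · rintro ⟨h0, h1, h2⟩
    rcases Nat.lt_or_ge t s with h | h
    · obtain rfl : s = t + 1 := by omega
      exact Or.inr ⟨rfl, isEvent_succ_iff.1 h2⟩
    · exact Or.inl ⟨h0, h, h2⟩
  · rintro (⟨h0, h1, h2⟩ | ⟨rfl, h⟩)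
    · exact ⟨h0, by omega, h2⟩
    · exact ⟨by omega, le_rfl, isEvent_succ_iff.2 h⟩

theorem liftClock_succ_of_mem {p : V} {t : ℕ} (h : p ∈ sched t) :
    liftClock sched bot0 δ0 p (t + 1) = liftClock sched bot0 δ0 p t + 1 := by
  have hfin : {s : ℕ | 0 < s ∧ s ≤ t ∧ isEvent sched p s}.Finite :=
    (Set.finite_Iic t).subset fun s hs => hs.2.1
  have hcard : {s : ℕ | 0 < s ∧ s ≤ t + 1 ∧ isEvent sched p s}.ncard =
      {s : ℕ | 0 < s ∧ s ≤ t ∧ isEvent sched p s}.ncard + 1 := by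
    rw [setOf_events_succ]
    have : {s : ℕ | s = t + 1 ∧ p ∈ sched t} = {t + 1} := by
      ext s
      simp [h]
    rw [this, Set.union_singleton, Set.ncard_insert_of_notMem _ hfin]
    simp
  change bot0 + δ0 p + (({s : ℕ | 0 < s ∧ s ≤ t + 1 ∧ isEvent sched p s}.ncard : ℕ) : ℤ) =
    bot0 + δ0 p + (({s : ℕ | 0 < s ∧ s ≤ t ∧ isEvent sched p s}.ncard : ℕ) : ℤ) + 1
  rw [hcard]
  push_cast
  ring

theorem liftClock_succ_of_notMem {p : V} {t : ℕ} (h : p ∉ sched t) :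
    liftClock sched bot0 δ0 p (t + 1) = liftClock sched bot0 δ0 p t := by
  have hset : {s : ℕ | 0 < s ∧ s ≤ t + 1 ∧ isEvent sched p s} =
      {s : ℕ | 0 < s ∧ s ≤ t ∧ isEvent sched p s} := by
    rw [setOf_events_succ]
    simp [h]
  change bot0 + δ0 p + (({s : ℕ | 0 < s ∧ s ≤ t + 1 ∧ isEvent sched p s}.ncard : ℕ) : ℤ) =
    bot0 + δ0 p + (({s : ℕ | 0 < s ∧ s ≤ t ∧ isEvent sched p s}.ncard : ℕ) : ℤ)
  rw [hset]

theorem liftClock_le_succ (p : V) (t : ℕ) :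
    liftClock sched bot0 δ0 p t ≤ liftClock sched bot0 δ0 p (t + 1) := by
  by_cases h : p ∈ sched t
  · rw [liftClock_succ_of_mem h]
    omega
  · rw [liftClock_succ_of_notMem h]

theorem liftClock_succ_le (p : V) (t : ℕ) :
    liftClock sched bot0 δ0 p (t + 1) ≤ liftClock sched bot0 δ0 p t + 1 := by
  by_cases h : p ∈ sched t
  · rw [liftClock_succ_of_mem h]
  · rw [liftClock_succ_of_notMem h]
    omega

theorem liftClock_monotone (p : V) : Monotone (liftClock sched bot0 δ0 p) :=
  monotone_nat_of_le_succ (liftClock_le_succ p)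

theorem exists_le_liftClock {p : V} (hinf : ∀ T : ℕ, ∃ t, T < t ∧ isEvent sched p t) (n : ℕ) :
    ∃ t, liftClock sched bot0 δ0 p 0 + n ≤ liftClock sched bot0 δ0 p t := by
  induction n with
  | zero => exact ⟨0, by simp⟩
  | succ n ih =>
    obtain ⟨T, hT⟩ := ih
    obtain ⟨t, ht, hev⟩ := hinf T
    obtain ⟨s, rfl⟩ : ∃ s, t = s + 1 := ⟨t - 1, by omega⟩
    refine ⟨s + 1, ?_⟩
    have := liftClock_monotone (sched := sched) (bot0 := bot0) (δ0 := δ0) p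
      (Nat.lt_succ_iff.1 ht)
    rw [liftClock_succ_of_mem (isEvent_succ_iff.1 hev)]
    push_cast
    omega

theorem exists_liftClock_eq {p : V} (hinf : ∀ T : ℕ, ∃ t, T < t ∧ isEvent sched p t) {k : ℤ}
    (hk : liftClock sched bot0 δ0 p 0 ≤ k) : ∃ t, liftClock sched bot0 δ0 p t = k := by
  classical
  have hex : ∃ t, k ≤ liftClock sched bot0 δ0 p t := by
    obtain ⟨t, ht⟩ := exists_le_liftClock (bot0 := bot0) (δ0 := δ0) hinf
      (k - liftClock sched bot0 δ0 p 0).toNat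
    exact ⟨t, by omega⟩
  refine ⟨Nat.find hex, le_antisymm ?_ (Nat.find_spec hex)⟩
  rcases hf : Nat.find hex with _ | t
  · exact hk
  · have hlt := Nat.find_min hex (m := t) (by omega)
    have := liftClock_succ_le (sched := sched) (bot0 := bot0) (δ0 := δ0) p t
    omega

theorem phiInc_modEq {x : ℤ} (hx : 0 ≤ x) : phiInc K x ≡ x + 1 [ZMOD K] := by
  simp [phiInc, hx, Int.ModEq]

theorem phiInc_mem_ring_s8 (hK : 0 < K) {x : ℤ} (hx : 0 ≤ x) :
    0 ≤ phiInc K x ∧ phiInc K x < K := by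
  simp only [phiInc, hx, if_true]
  exact ⟨Int.emod_nonneg _ hK.ne', Int.emod_lt_of_pos _ hK⟩

theorem dsub_modEq (a b : ℤ) : dsub K a b ≡ b - a [ZMOD K] := by
  unfold dsub
  split_ifs
  · exact Int.mod_modEq _ _
  · simpa using (Int.mod_modEq (a - b) K).neg

theorem abs_dsub_le_one (hK : 0 < K) {a b : ℤ} (h : LocComp K a b) : |dsub K a b| ≤ 1 := by
  have h1 := Int.emod_nonneg (a - b) hK.ne'
  have h2 := Int.emod_nonneg (b - a) hK.ne'
  unfold LocComp at h
  rw [abs_le]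
  unfold dsub
  split_ifs <;> omega

theorem walkDelay_concat (γ : V → ℤ) {u p q : V} (w : G.Walk u p) (h : G.Adj p q) :
    walkDelay K γ (w.concat h) = walkDelay K γ w + dsub K (γ p) (γ q) := by
  simp [walkDelay]

theorem abs_walkDelay_le_length (hK : 0 < K) {γ : V → ℤ} (hγ : WU G K γ) {p q : V}
    (w : G.Walk p q) : |walkDelay K γ w| ≤ w.length := by
  induction w with
  | nil => simp [walkDelay]
  | @cons a b c h w ih =>
    have h1 := abs_dsub_le_one hK (hγ _ _ h).2
    have : walkDelay K γ (Walk.cons h w) = dsub K (γ a) (γ b) + walkDelay K γ w := by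
      simp [walkDelay]
    rw [this, Walk.length_cons]
    push_cast
    have := abs_add_le (dsub K (γ a) (γ b)) (walkDelay K γ w)
    omega

theorem walkDelay_modEq (γ : V → ℤ) {p q : V} (w : G.Walk p q) :
    walkDelay K γ w ≡ γ q - γ p [ZMOD K] := by
  induction w with
  | nil => simp [walkDelay]
  | @cons a b c h w ih =>
    have : walkDelay K γ (Walk.cons h w) = dsub K (γ a) (γ b) + walkDelay K γ w := by
      simp [walkDelay]
    rw [this]
    have := (dsub_modEq (γ a) (γ b)).add ih
    rwa [show γ b - γ a + (γ c - γ b) = γ c - γ a by ring] at this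

/-- `L` lifts the configuration `γ` to the integers: it projects to `γ` modulo `K`, and
neighbors differ by at most one. -/
structure IsLift (G : SimpleGraph V) (K : ℤ) (γ L : V → ℤ) : Prop where
  mem_ring : ∀ p, 0 ≤ γ p ∧ γ p < K
  modEq : ∀ p, γ p ≡ L p [ZMOD K]
  le_add_one : ∀ p q, G.Adj p q → L q ≤ L p + 1

theorem IsLift.le_of_enabled (hK : 3 ≤ K) {γ L : V → ℤ} (hL : IsLift G K γ L) {p q : V}
    (hp : NAenabled G K γ p) (hpq : G.Adj p q) : L p ≤ L q := by
  have h1 := hL.le_add_one q p hpq.symm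
  by_contra! hlt
  have hq : γ q ≡ L p - 1 [ZMOD K] := by
    have := hL.modEq q
    rwa [show L q = L p - 1 by omega] at this
  have key : ∀ c : ℤ, γ q ≡ L p + c [ZMOD K] → K ∣ c + 1 := by
    intro c hc
    have := (hq.symm.trans hc).dvd
    rwa [show L p + c - (L p - 1) = c + 1 by ring] at this
  rcases hp.2 q hpq with h | h
  · have := Int.le_of_dvd (by norm_num) (key 0 (by rw [h, add_zero]; exact hL.modEq p))
    omega
  · have := Int.le_of_dvd (by norm_num)
      (key 1 (by rw [h]; exact (phiInc_modEq hp.1.1).trans ((hL.modEq p).add_right 1)))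
    omega

theorem IsLift.step (hK : 3 ≤ K) {γ γ' : V → ℤ} {t : ℕ}
    (hL : IsLift G K γ fun p => liftClock sched bot0 δ0 p t)
    (hstep : NAstep G K γ γ' (sched t)) :
    IsLift G K γ' fun p => liftClock sched bot0 δ0 p (t + 1) := by
  obtain ⟨-, hen, hval⟩ := hstep
  refine ⟨fun p => ?_, fun p => ?_, fun p q hpq => ?_⟩
  · by_cases hp : p ∈ sched t
    · rw [(hval p).1 hp]
      exact phiInc_mem_ring_s8 (by omega) (hL.mem_ring p).1
    · rw [(hval p).2 hp]
      exact hL.mem_ring p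
  · by_cases hp : p ∈ sched t
    · simp only [(hval p).1 hp, liftClock_succ_of_mem hp]
      exact (phiInc_modEq (hL.mem_ring p).1).trans ((hL.modEq p).add_right 1)
    · simp only [(hval p).2 hp, liftClock_succ_of_notMem hp]
      exact hL.modEq p
  · have hp := liftClock_le_succ (sched := sched) (bot0 := bot0) (δ0 := δ0) p t
    by_cases hq : q ∈ sched t
    · have := hL.le_of_enabled hK (hen q hq) hpq.symm
      simp only [liftClock_succ_of_mem hq] at this ⊢
      omega
    · have := hL.le_add_one p q hpq
      simp only [liftClock_succ_of_notMem hq] at this ⊢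
      omega

theorem isLift_zero [Nontrivial V] (hconn : G.Connected) (hK : 0 < K) {γ : V → ℤ}
    (hγ : WU G K γ) {p₀ : V} (hδ0 : ∀ q : V, ∀ w : G.Walk p₀ q, walkDelay K γ w = δ0 q) :
    IsLift G K γ fun p => liftClock sched (γ p₀) δ0 p 0 := by
  simp only [liftClock_zero]
  refine ⟨fun p => ?_, fun p => ?_, fun p q hpq => ?_⟩
  · obtain ⟨q, hq⟩ := hconn.preconnected.exists_adj_of_nontrivial p
    exact (hγ p q hq).1
  · obtain ⟨w⟩ := hconn.preconnected p₀ p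
    have := (walkDelay_modEq (K := K) γ w).add_left (γ p₀)
    rw [hδ0 p w, add_sub_cancel] at this
    exact this.symm
  · obtain ⟨w⟩ := hconn.preconnected p₀ p
    have h1 := walkDelay_concat (K := K) γ w hpq
    rw [hδ0, hδ0] at h1
    have := (abs_le.1 (abs_dsub_le_one hK (hγ _ _ hpq).2)).2
    omega

theorem liftClock_le_of_leads
    (hL : ∀ t p q, G.Adj p q →
      liftClock sched bot0 δ0 q t ≤ liftClock sched bot0 δ0 p t + 1)
    {a b : V × ℕ} (h : Leads G sched a b) :
    liftClock sched bot0 δ0 a.1 a.2 ≤ liftClock sched bot0 δ0 b.1 b.2 := by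
  cases h with
  | self _ _ hlt _ => exact liftClock_monotone _ hlt.le
  | @nbr p q t' t hpq hev hpos _ hlt _ =>
    obtain ⟨s, rfl⟩ : ∃ s, t = s + 1 := ⟨t - 1, by omega⟩
    simp only [liftClock_succ_of_mem (isEvent_succ_iff.1 hev)]
    exact (liftClock_monotone q (Nat.lt_succ_iff.1 hlt)).trans (hL s p q hpq)

theorem liftClock_le_of_causalLe
    (hL : ∀ t p q, G.Adj p q →
      liftClock sched bot0 δ0 q t ≤ liftClock sched bot0 δ0 p t + 1)
    {a b : V × ℕ} (h : CausalLe G sched a b) :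
    liftClock sched bot0 δ0 a.1 a.2 ≤ liftClock sched bot0 δ0 b.1 b.2 := by
  induction h with
  | refl => exact le_rfl
  | tail _ h ih => exact ih.trans (liftClock_le_of_leads hL h)

theorem Leads.isEvent_left {a b : V × ℕ} (h : Leads G sched a b) : isEvent sched a.1 a.2 := by
  cases h <;> assumption

theorem isEvent.le_of_liftClock_le {p : V} {t s : ℕ} (h : isEvent sched p t)
    (hle : liftClock sched bot0 δ0 p t ≤ liftClock sched bot0 δ0 p s) : t ≤ s := by
  rcases t with _ | t
  · exact Nat.zero_le s
  · by_contra! hlt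
    have := liftClock_monotone (sched := sched) (bot0 := bot0) (δ0 := δ0) p
      (Nat.lt_succ_iff.1 hlt)
    rw [liftClock_succ_of_mem (isEvent_succ_iff.1 h)] at hle
    omega

end Clock

/-- In any execution from a configuration in `WU₀` in which every process has infinitely
many events, for every `k ≥ ⊥₀ + D` (`D` the diameter) the cut
`C_k = {(p, t_{p,k}) : p ∈ V}` is well defined (for every `p` some time `t` has lifted
clock value `ṽ(p,t) = k`, so the least such time `t_{p,k}` exists) and coherent: whenever
`(q,t') ≼ (p,t)` and `t ≤ t_{p,k}`, then `t' ≤ t_{q,k}`. -/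
theorem cut_well_defined_and_coherent {V : Type*} [Fintype V] (G : SimpleGraph V)
    (hconn : G.Connected) (hn : 2 ≤ Fintype.card V)
    (K α : ℤ) (hK : 3 ≤ K) (hα : 0 ≤ α)
    (e : ℕ → V → ℤ) (sched : ℕ → Set V)
    (hX : ∀ t, ∀ p : V, -α ≤ e t p ∧ e t p < K)
    (hWU0 : WU G K (e 0) ∧ Intrinsic G K (e 0))
    (hexec : ∀ t, NAstep G K (e t) (e (t + 1)) (sched t))
    (hinf : ∀ (p : V) (T : ℕ), ∃ t, T < t ∧ isEvent sched p t)
    (p₀ : V) (δ0 : V → ℤ)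
    (hδ0 : ∀ q : V, ∀ w : G.Walk p₀ q, walkDelay K (e 0) w = δ0 q)
    (hmin : ∀ q : V, 0 ≤ δ0 q)
    (k : ℤ) (hk : e 0 p₀ + (G.diam : ℤ) ≤ k) :
    (∀ p : V, ∃ t : ℕ, liftClock sched (e 0 p₀) δ0 p t = k) ∧
    (∀ (p q : V) (t t' tpk tqk : ℕ),
      (liftClock sched (e 0 p₀) δ0 p tpk = k ∧
        ∀ s, liftClock sched (e 0 p₀) δ0 p s = k → tpk ≤ s) →
      (liftClock sched (e 0 p₀) δ0 q tqk = k ∧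
        ∀ s, liftClock sched (e 0 p₀) δ0 q s = k → tqk ≤ s) →
      CausalLe G sched (q, t') (p, t) → t ≤ tpk → t' ≤ tqk) := by
  have hK0 : 0 < K := by omega
  have : Nontrivial V := Fintype.one_lt_card_iff_nontrivial.1 hn
  have hlift : ∀ t, IsLift G K (e t) fun p => liftClock sched (e 0 p₀) δ0 p t := by
    intro t
    induction t with
    | zero => exact isLift_zero hconn hK0 hWU0.1 hδ0
    | succ t ih => exact ih.step hK (hexec t)
  have hadj t := (hlift t).le_add_one
  refine ⟨fun p => exists_liftClock_eq (hinf p) ?_, ?_⟩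
  · obtain ⟨w, hw⟩ := hconn.exists_walk_length_eq_dist p₀ p
    have h1 := (abs_le.1 (abs_walkDelay_le_length hK0 hWU0.1 w)).2
    have h2 : G.dist p₀ p ≤ G.diam :=
      dist_le_diam (connected_iff_ediam_ne_top.1 hconn)
    rw [hδ0, hw] at h1
    rw [liftClock_zero]
    omega
  · rintro p q t t' tpk tqk ⟨hp, hpmin⟩ ⟨hq, -⟩ hle ht
    rcases hle.cases_head with heq | ⟨c, hlead, -⟩
    · obtain ⟨rfl, rfl⟩ := Prod.mk.inj heq
      exact ht.trans (hpmin tqk hq)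
    · refine hlead.isEvent_left.le_of_liftClock_le (bot0 := e 0 p₀) (δ0 := δ0) ?_
      have h1 := liftClock_le_of_causalLe hadj hle
      have h2 := liftClock_monotone (sched := sched) (bot0 := e 0 p₀) (δ0 := δ0) p ht
      simp only at h1 ⊢
      omega
end
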